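/- Let A be an associative unital algebra over k = ℚ(q) containing elements E, F, K₊, K₋ satisfying the U_q(s̃l₂) relations, let C⁽ᵐ⁾ be the Chebyshev-type central elements, and for t ≥ 0 set X_t := Σ_{s=0}^{t} (−1)^s q^s · binom[q²]{t}{s} · K₊^s F^{t−s} E^{t−s}. Then for every integer m ≥ 0: C⁽ᵐ⁾ = Σ_{0 ≤ i ≤ j, i+j ≤ m} (−1)^{j} q^{−j−i²} · binom[q⁻²]{m−i}{j} · binom[q⁻²]{j}{i} · K₊^{i} K₋^{j} · X_{m−i−j}. -/

import Mathlib

noncomputable section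

/-- The Gaussian binomial coefficient `binom[v]{a}{n} = ∏_{t=1}^{n} (v^{a-n+t} - 1)/(v^t - 1)`,
evaluated at `v ∈ ℚ(q)`. -/
def gbinom (v : RatFunc ℚ) (a n : ℕ) : RatFunc ℚ :=
  ∏ t ∈ Finset.range n, (v ^ (a - n + t + 1) - 1) / (v ^ (t + 1) - 1)

/-- The Chebyshev-type elements `C⁽⁰⁾ = 1`, `C⁽¹⁾ = C`,
`C⁽ᵐ⁺¹⁾ = C·C⁽ᵐ⁾ - K₊K₋·C⁽ᵐ⁻¹⁾` (for `m ≥ 1`), where `KK = K₊K₋`. -/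
def cheb {A : Type*} [Ring A] (C KK : A) : ℕ → A
  | 0 => 1
  | 1 => C
  | n + 2 => C * cheb C KK (n + 1) - KK * cheb C KK n

/-- The Gaussian binomial coefficient as a product whose numerator vanishes for `n < k`. -/
def qbin {k : Type*} [Field k] (v : k) (n l : ℕ) : k :=
  ∏ t ∈ Finset.range l, (v ^ (n - t) - 1) / (v ^ (t + 1) - 1)

section QBin

variable {k : Type*} [Field k] {v : k}

@[simp] theorem qbin_zero_right (n : ℕ) : qbin v n 0 = 1 := by simp [qbin]

theorem qbin_eq_zero {n l : ℕ} (h : n < l) : qbin v n l = 0 :=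
  Finset.prod_eq_zero (Finset.mem_range.2 h) (by simp)

theorem gbinom_eq_qbin (v : RatFunc ℚ) {a n : ℕ} (h : n ≤ a) : gbinom v a n = qbin v a n := by
  unfold gbinom qbin
  rw [Finset.prod_div_distrib, Finset.prod_div_distrib]
  congr 1
  rw [← Finset.prod_range_reflect]
  refine Finset.prod_congr rfl fun t ht => ?_
  have := Finset.mem_range.1 ht
  congr 2
  omega

theorem qbin_succ_right_mul (hv : ∀ t : ℕ, v ^ (t + 1) - 1 ≠ 0) (n l : ℕ) :
    qbin v n (l + 1) * (v ^ (l + 1) - 1) = (v ^ (n - l) - 1) * qbin v n l := by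
  have := hv l
  rw [qbin, Finset.prod_range_succ, ← qbin]
  field_simp

theorem qbin_succ_succ_mul (hv : ∀ t : ℕ, v ^ (t + 1) - 1 ≠ 0) (n l : ℕ) :
    qbin v (n + 1) (l + 1) * (v ^ (l + 1) - 1) = (v ^ (n + 1) - 1) * qbin v n l := by
  induction l with
  | zero =>
    rw [qbin_succ_right_mul hv]
    simp
  | succ l ih =>
    rw [qbin_succ_right_mul hv, Nat.add_sub_add_right]
    refine mul_right_cancel₀ (hv l) ?_
    rw [mul_assoc, ih, mul_assoc, qbin_succ_right_mul hv]
    ring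

theorem qbin_succ_left_mul (hv : ∀ t : ℕ, v ^ (t + 1) - 1 ≠ 0) (n l : ℕ) :
    (v ^ (n + 1 - l) - 1) * qbin v (n + 1) l = (v ^ (n + 1) - 1) * qbin v n l := by
  rw [← qbin_succ_right_mul hv, qbin_succ_succ_mul hv]

/-- The Pascal rule, multiplied by a power of `v` to avoid subtraction in the exponent. -/
theorem pow_mul_qbin_succ_succ (hv : ∀ t : ℕ, v ^ (t + 1) - 1 ≠ 0) (n l : ℕ) :
    v ^ l * qbin v (n + 1) (l + 1) = v ^ l * qbin v n (l + 1) + v ^ n * qbin v n l := by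
  rcases le_or_gt l n with h | h
  · obtain ⟨r, rfl⟩ := Nat.exists_eq_add_of_le h
    refine mul_right_cancel₀ (hv l) ?_
    have h1 := qbin_succ_succ_mul hv (l + r) l
    have h2 := qbin_succ_right_mul hv (l + r) l
    rw [Nat.add_sub_cancel_left] at h2
    linear_combination v ^ l * h1 - v ^ l * h2
  · simp [qbin_eq_zero h, qbin_eq_zero (h.trans l.lt_succ_self),
      qbin_eq_zero (Nat.succ_lt_succ h)]

theorem qbin_add_succ_succ (hv : ∀ t : ℕ, v ^ (t + 1) - 1 ≠ 0) (l r : ℕ) :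
    qbin v (l + r + 1) (l + 1) = qbin v (l + r) (l + 1) + v ^ r * qbin v (l + r) l := by
  refine mul_right_cancel₀ (hv l) ?_
  have h1 := qbin_succ_succ_mul hv (l + r) l
  have h2 := qbin_succ_right_mul hv (l + r) l
  rw [Nat.add_sub_cancel_left] at h2
  linear_combination h1 - h2

end QBin

/-- The coefficient of `K₊^i K₋^j X_{m-i-j}` in `C⁽ᵐ⁾`, in terms of `u = q⁻¹`. -/
def chebCoeff {k : Type*} [Field k] (u : k) (m i j : ℕ) : k :=
  (-1) ^ j * u ^ (j + i ^ 2) * qbin (u ^ 2) (m - i) j * qbin (u ^ 2) j i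

section ChebCoeff

variable {k : Type*} [Field k] {u : k}

theorem chebCoeff_eq_zero {m i j : ℕ} (h : j < i ∨ m < i + j) : chebCoeff u m i j = 0 := by
  unfold chebCoeff
  rcases lt_or_ge j i with hji | hji
  · simp [qbin_eq_zero hji]
  · rw [qbin_eq_zero (show m - i < j by omega)]
    simp

theorem chebCoeff_zero_right (m m' i : ℕ) : chebCoeff u m i 0 = chebCoeff u m' i 0 := by
  simp [chebCoeff]

theorem chebCoeff_zero_succ (hv : ∀ t : ℕ, (u ^ 2) ^ (t + 1) - 1 ≠ 0) (m j : ℕ) :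
    chebCoeff u (m + 1) 0 (j + 1) =
      chebCoeff u m 0 (j + 1) - u ^ (2 * (m - 0 - j) + 1) * chebCoeff u m 0 j := by
  rcases le_or_gt j m with h | h
  · obtain ⟨r, rfl⟩ := Nat.exists_eq_add_of_le h
    simp only [chebCoeff, Nat.sub_zero, Nat.add_sub_cancel_left, qbin_zero_right,
      qbin_add_succ_succ hv]
    ring
  · rw [chebCoeff_eq_zero (by omega), chebCoeff_eq_zero (by omega), chebCoeff_eq_zero (by omega)]
    simp

theorem chebCoeff_succ_succ (hv : ∀ t : ℕ, (u ^ 2) ^ (t + 1) - 1 ≠ 0) (m i j : ℕ) :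
    chebCoeff u (m + 2) (i + 1) (j + 1) =
      chebCoeff u (m + 1) (i + 1) (j + 1)
        - u ^ (2 * (m + 1 - (i + 1) - j) + 1) * chebCoeff u (m + 1) (i + 1) j
        + ((1 - u ^ (2 * (m + 1 - i - j))) * chebCoeff u (m + 1) i j - chebCoeff u m i j) := by
  rcases le_or_gt (i + j) m with h | h
  · obtain ⟨r, rfl⟩ := Nat.exists_eq_add_of_le h
    have e1 : i + j + r + 2 - (i + 1) = j + r + 1 := by omega
    have e2 : i + j + r + 1 - (i + 1) = j + r := by omega
    have e3 : i + j + r + 1 - i = j + r + 1 := by omega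
    have e4 : i + j + r - i = j + r := by omega
    have e5 : j + r + 1 - j = r + 1 := by omega
    simp only [chebCoeff, e1, e2, e3, e4, e5, Nat.add_sub_cancel_left, qbin_add_succ_succ hv]
    have h1 := pow_mul_qbin_succ_succ hv j i
    have h2 := qbin_succ_left_mul hv (j + r) j
    rw [e5] at h2
    linear_combination (-1) ^ (j + 1) * u ^ (j + i ^ 2) * (u ^ 2) ^ (r + 1) *
      qbin (u ^ 2) (j + r) j * h1 + (-1) ^ j * u ^ (j + i ^ 2) * qbin (u ^ 2) j i * h2
  · rw [chebCoeff_eq_zero (by omega), chebCoeff_eq_zero (by omega), chebCoeff_eq_zero (by omega),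
      chebCoeff_eq_zero (m := m) (by omega)]
    rcases Nat.lt_or_ge (m + 1) (i + j) with h' | h'
    · rw [chebCoeff_eq_zero (by omega)]
      simp
    · simp [show m + 1 - i - j = 0 by omega]

end ChebCoeff

/-- Summation of an array obtained from `g`, the shift of `h` by `(1, 0)` and the shift of `p` by
`(1, 1)`. -/
theorem sum_sum_range_shift {A : Type*} [AddCommMonoid A] {f g h p : ℕ → ℕ → A} {M : ℕ}
    (h₀ : ∀ i, f 0 i = g 0 i) (h₁ : ∀ j, f (j + 1) 0 = g (j + 1) 0 + h j 0)
    (h₂ : ∀ j i, f (j + 1) (i + 1) = g (j + 1) (i + 1) + h j (i + 1) + p j i)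
    (hh : ∀ i, h M i = 0) (hp : ∀ i, p M i = 0) (hp' : ∀ j, p j M = 0) :
    ∑ j ∈ Finset.range (M + 1), ∑ i ∈ Finset.range (M + 1), f j i =
      ∑ j ∈ Finset.range (M + 1), ∑ i ∈ Finset.range (M + 1), g j i
        + ∑ j ∈ Finset.range (M + 1), ∑ i ∈ Finset.range (M + 1), h j i
        + ∑ j ∈ Finset.range (M + 1), ∑ i ∈ Finset.range (M + 1), p j i := by
  have row (j : ℕ) : ∑ i ∈ Finset.range (M + 1), f (j + 1) i =
      ∑ i ∈ Finset.range (M + 1), g (j + 1) i + ∑ i ∈ Finset.range (M + 1), h j i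
        + ∑ i ∈ Finset.range (M + 1), p j i := by
    rw [Finset.sum_range_succ', Finset.sum_range_succ' (g (j + 1)), Finset.sum_range_succ' (h j),
      Finset.sum_range_succ (p j), hp', h₁]
    simp only [h₂, Finset.sum_add_distrib]
    abel
  rw [Finset.sum_range_succ', Finset.sum_range_succ' (fun j => ∑ i ∈ _, g j i),
    Finset.sum_range_succ (fun j => ∑ i ∈ _, h j i),
    Finset.sum_range_succ (fun j => ∑ i ∈ _, p j i)]
  simp only [row, h₀, hh, hp, Finset.sum_add_distrib, Finset.sum_const_zero]
  abel

section Recurrence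

variable {k A : Type*} [Field k] [Ring A] [Algebra k A]

/-- The elements `X_t` built from a sequence `Y_t`, which plays the role of `F^t E^t`. -/
def bigHermite (q : k) (a : A) (Y : ℕ → A) (t : ℕ) : A :=
  ∑ s ∈ Finset.range (t + 1), ((-1) ^ s * q ^ s * qbin (q ^ 2) t s) • (a ^ s * Y (t - s))

/-- The three-term recurrence of the continuous big `q`-Hermite polynomials. -/
theorem mul_bigHermite {q u : k} (hqu : q * u = 1) (hv : ∀ t : ℕ, (q ^ 2) ^ (t + 1) - 1 ≠ 0)
    {a b C : A} {Y : ℕ → A} (hab : Commute a b) (hCa : Commute C a)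
    (hY : ∀ t, C * Y t =
      Y (t + 1) - q ^ (2 * t + 1) • (a * Y t) - u ^ (2 * t + 1) • (b * Y t)) (n : ℕ) :
    C * bigHermite q a Y n = bigHermite q a Y (n + 1)
      - u ^ (2 * n + 1) • (b * bigHermite q a Y n)
      + (1 - u ^ (2 * n)) • (a * b * bigHermite q a Y (n - 1)) := by
  obtain ⟨d, hd⟩ : ∃ d : ℕ → ℕ → k, d = fun n s => (-1) ^ s * q ^ s * qbin (q ^ 2) n s :=
    ⟨_, rfl⟩
  have hX (n : ℕ) : bigHermite q a Y n =
      ∑ s ∈ Finset.range (n + 1), d n s • (a ^ s * Y (n - s)) := by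
    rw [hd, bigHermite]
  have hterm (s : ℕ) : C * (d n s • (a ^ s * Y (n - s))) =
      d n s • (a ^ s * Y (n - s + 1))
        - (q ^ (2 * (n - s) + 1) * d n s) • (a ^ (s + 1) * Y (n - s))
        - (u ^ (2 * (n - s) + 1) * d n s) • (b * a ^ s * Y (n - s)) := by
    rw [mul_smul_comm, ← mul_assoc, (hCa.pow_right s).eq, mul_assoc, hY, ← (hab.pow_left s).eq,
      pow_succ a]
    simp only [mul_sub, smul_sub, mul_smul_comm, mul_assoc, mul_smul, smul_comm (d n s)]
  have hup : ∑ s ∈ Finset.range (n + 1), d n s • (a ^ s * Y (n - s + 1))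
      - ∑ s ∈ Finset.range (n + 1),
        (q ^ (2 * (n - s) + 1) * d n s) • (a ^ (s + 1) * Y (n - s)) =
      bigHermite q a Y (n + 1) := by
    have h1 : ∑ s ∈ Finset.range (n + 1), d n s • (a ^ s * Y (n - s + 1)) =
        ∑ s ∈ Finset.range (n + 2), d n s • (a ^ s * Y (n + 1 - s)) := by
      rw [Finset.sum_range_succ _ (n + 1), hd]
      simp only [qbin_eq_zero n.lt_succ_self, mul_zero, zero_smul, add_zero]
      refine Finset.sum_congr rfl fun s hs => ?_
      rw [Nat.sub_add_comm (Nat.lt_succ_iff.1 (Finset.mem_range.1 hs))]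
    rw [h1, hX, Finset.sum_range_succ', Finset.sum_range_succ' _ (n + 1), add_sub_right_comm,
      ← Finset.sum_sub_distrib]
    congr 1
    · refine Finset.sum_congr rfl fun s hs => ?_
      rw [Nat.add_sub_add_right, ← sub_smul]
      congr 1
      obtain ⟨r, rfl⟩ := Nat.exists_eq_add_of_le (Nat.lt_succ_iff.1 (Finset.mem_range.1 hs))
      simp only [hd, Nat.add_sub_cancel_left, qbin_add_succ_succ hv]
      ring
    · simp [hd]
  have hdown : ∑ s ∈ Finset.range (n + 1),
        (u ^ (2 * (n - s) + 1) * d n s) • (b * a ^ s * Y (n - s)) =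
      u ^ (2 * n + 1) • (b * bigHermite q a Y n)
        - (1 - u ^ (2 * n)) • (a * b * bigHermite q a Y (n - 1)) := by
    rw [hX n, Finset.mul_sum, Finset.smul_sum, eq_sub_iff_add_eq, ← eq_sub_iff_add_eq',
      ← Finset.sum_sub_distrib, Finset.sum_range_succ']
    have h0 : u ^ (2 * n + 1) • (b * d n 0 • (a ^ 0 * Y (n - 0)))
        - (u ^ (2 * (n - 0) + 1) * d n 0) • (b * a ^ 0 * Y (n - 0)) = 0 := by
      simp [hd]
    rw [h0, add_zero]
    rcases n with _ | n
    · simp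
    rw [Nat.add_sub_cancel, hX n, Finset.mul_sum, Finset.smul_sum]
    refine Finset.sum_congr rfl fun s hs => ?_
    have hcomm : a * b * (a ^ s * Y (n - s)) = b * a ^ (s + 1) * Y (n - s) := by
      rw [hab.eq, pow_succ']
      simp only [mul_assoc]
    rw [Nat.add_sub_add_right, mul_smul_comm, mul_smul_comm, hcomm, ← mul_assoc b, smul_smul,
      smul_smul, ← sub_smul]
    congr 1
    obtain ⟨r, rfl⟩ := Nat.exists_eq_add_of_le (Nat.lt_succ_iff.1 (Finset.mem_range.1 hs))
    have h1 := qbin_succ_succ_mul hv (s + r) s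
    have h2 (e : ℕ) : q ^ e * u ^ e = 1 := by rw [← mul_pow, hqu, one_pow]
    have h3 : u ^ (2 * r + 1) = q ^ (2 * (s + 1)) * u ^ (2 * (s + r + 1) + 1) := by
      linear_combination (-u ^ (2 * r + 1)) * h2 (2 * (s + 1))
    simp only [hd, Nat.add_sub_cancel_left, h3]
    have h4 := h2 (2 * (s + r + 1))
    linear_combination (-1) ^ (s + 1) * q ^ s * (u ^ (2 * (s + r + 1)) * h1 + qbin (q ^ 2) (s + r) s * h4
      + u ^ (2 * (s + r + 1)) * qbin (q ^ 2) (s + r + 1) (s + 1) *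
        ((q ^ 2) ^ (s + 1) - 1) * hqu)
  rw [hX n, Finset.mul_sum, ← hX n, Finset.sum_congr rfl fun s _ => hterm s,
    Finset.sum_sub_distrib, Finset.sum_sub_distrib, hup, hdown]
  abel

/-- The Chebyshev-type elements in terms of any sequence satisfying the continuous big
`q`-Hermite recurrence. -/
theorem cheb_eq_sum_chebCoeff {u : k} (hv : ∀ t : ℕ, (u ^ 2) ^ (t + 1) - 1 ≠ 0)
    {a b C : A} {X : ℕ → A} (hab : Commute a b) (hCa : Commute C a) (hCb : Commute C b)
    (hX₀ : X 0 = 1)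
    (hX : ∀ n, C * X n = X (n + 1) - u ^ (2 * n + 1) • (b * X n)
      + (1 - u ^ (2 * n)) • (a * b * X (n - 1))) {M m : ℕ} (hm : m ≤ M) :
    cheb C (a * b) m = ∑ j ∈ Finset.range (M + 1), ∑ i ∈ Finset.range (M + 1),
      chebCoeff u m i j • (a ^ i * b ^ j * X (m - i - j)) := by
  have hC (m i j : ℕ) : C * (chebCoeff u m i j • (a ^ i * b ^ j * X (m - i - j))) =
      chebCoeff u m i j • (a ^ i * b ^ j * X (m + 1 - i - j))
        + (-(u ^ (2 * (m - i - j) + 1) * chebCoeff u m i j)) •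
          (a ^ i * b ^ (j + 1) * X (m + 1 - i - (j + 1)))
        + ((1 - u ^ (2 * (m - i - j))) * chebCoeff u m i j) •
          (a ^ (i + 1) * b ^ (j + 1) * X (m + 1 - (i + 1) - (j + 1))) := by
    rcases lt_or_ge m (i + j) with h | h
    · simp [chebCoeff_eq_zero (Or.inr h)]
    obtain ⟨r, rfl⟩ := Nat.exists_eq_add_of_le h
    rw [show i + j + r - i - j = r by omega, show i + j + r + 1 - i - j = r + 1 by omega,
      show i + j + r + 1 - i - (j + 1) = r by omega,
      show i + j + r + 1 - (i + 1) - (j + 1) = r - 1 by omega, mul_smul_comm, ← mul_assoc,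
      ((hCa.pow_right i).mul_right (hCb.pow_right j)).eq, mul_assoc, hX]
    have h1 : a ^ (i + 1) * b ^ (j + 1) = a ^ i * b ^ j * (a * b) := by
      rw [pow_succ, pow_succ, mul_assoc, ← mul_assoc a, (hab.pow_right j).eq]
      simp only [mul_assoc]
    rw [h1, pow_succ b]
    simp only [mul_add, mul_sub, smul_add, smul_sub, mul_smul_comm, neg_smul, mul_smul, mul_assoc,
      smul_comm (chebCoeff u _ i j), ← sub_eq_add_neg]
  have hKK (m i j : ℕ) :
      a * b * (chebCoeff u m i j • (a ^ i * b ^ j * X (m - i - j))) =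
        chebCoeff u m i j • (a ^ (i + 1) * b ^ (j + 1) * X (m + 2 - (i + 1) - (j + 1))) := by
    rw [show m + 2 - (i + 1) - (j + 1) = m - i - j by omega, mul_smul_comm, ← mul_assoc,
      pow_succ', pow_succ', mul_assoc a b, ← mul_assoc b, ← (hab.pow_left i).eq]
    simp only [mul_assoc]
  induction m using Nat.twoStepInduction with
  | zero =>
    rw [Finset.sum_eq_single 0, Finset.sum_eq_single 0]
    · simp [cheb, chebCoeff, hX₀]
    · intro i _ hi
      simp [chebCoeff_eq_zero (show 0 < i ∨ 0 < i + 0 by omega)]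
    · simp
    · intro j _ hj
      refine Finset.sum_eq_zero fun i _ => ?_
      simp [chebCoeff_eq_zero (show j < i ∨ 0 < i + j by omega)]
    · simp
  | one =>
    have hC₁ : C = X 1 - u • b := by simpa [hX₀] using hX 0
    have hsum (j : ℕ) : ∑ i ∈ Finset.range (M + 1),
        chebCoeff u 1 i j • (a ^ i * b ^ j * X (1 - i - j)) =
          chebCoeff u 1 0 j • (b ^ j * X (1 - j)) := by
      rw [Finset.sum_eq_single 0]
      · simp
      · intro i _ hi
        simp [chebCoeff_eq_zero (show j < i ∨ 1 < i + j by omega)]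
      · simp
    simp only [hsum]
    rw [← Finset.sum_subset (Finset.range_subset_range.2 (show 2 ≤ M + 1 by omega))]
    · have := hv 0
      simp only [zero_add, pow_one] at this
      simp [Finset.sum_range_succ, cheb, chebCoeff, qbin, hX₀, hC₁, div_self this,
        sub_eq_add_neg (X 1)]
    · intro j _ hj
      rw [Finset.mem_range] at hj
      rw [chebCoeff_eq_zero (by omega), zero_smul]
  | more m ih₀ ih₁ =>
    rw [cheb, ih₀ (by omega), ih₁ (by omega), Finset.mul_sum, Finset.mul_sum]
    simp only [Finset.mul_sum, hC, hKK, Finset.sum_add_distrib]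
    rw [add_sub_assoc, ← Finset.sum_sub_distrib]
    simp only [← Finset.sum_sub_distrib, ← sub_smul]
    symm
    refine sum_sum_range_shift ?_ ?_ ?_ ?_ ?_ ?_
    · intro i
      rw [chebCoeff_zero_right (m + 2) (m + 1)]
    · intro j
      rw [chebCoeff_zero_succ hv, sub_smul, neg_smul, sub_eq_add_neg]
    · intro j i
      rw [chebCoeff_succ_succ hv, add_smul, sub_smul, neg_smul, sub_eq_add_neg]
    · intro i
      simp [chebCoeff_eq_zero (show M < i ∨ m + 1 < i + M by omega)]
    · intro i
      simp [chebCoeff_eq_zero (show M < i ∨ m + 1 < i + M by omega),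
        chebCoeff_eq_zero (show M < i ∨ m < i + M by omega)]
    · intro j
      simp [chebCoeff_eq_zero (show j < M ∨ m + 1 < M + j by omega),
        chebCoeff_eq_zero (show j < M ∨ m < M + j by omega)]

end Recurrence

/-- the expression of `C⁽ᵐ⁾` through the elements
`X_t = ∑_{s=0}^t (-1)^s q^s binom[q²]{t}{s} K₊^s F^{t-s} E^{t-s}`. -/
theorem statement8 {A : Type*} [Ring A] [Algebra (RatFunc ℚ) A]
    (q : RatFunc ℚ) (hq : q = RatFunc.X)
    (E F Kp Km : A)
    (hK : Kp * Km = Km * Kp)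
    (hKpE : Kp * E = (q ^ 2) • (E * Kp))
    (hKmE : Km * E = (q⁻¹ ^ 2) • (E * Km))
    (hKpF : Kp * F = (q⁻¹ ^ 2) • (F * Kp))
    (hKmF : Km * F = (q ^ 2) • (F * Km))
    (hEF : E * F - F * E = (q⁻¹ - q) • (Kp - Km))
    (C : A) (hC : C = F * E - q • Kp - q⁻¹ • Km)
    (X : ℕ → A)
    (hX : ∀ t : ℕ, X t = ∑ s ∈ Finset.range (t + 1),
      (((-1 : RatFunc ℚ) ^ s * q ^ s * gbinom (q ^ 2) t s) •
        (Kp ^ s * F ^ (t - s) * E ^ (t - s))))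
    (m : ℕ) :
    cheb C (Kp * Km) m =
      ∑ j ∈ Finset.range (m + 1), ∑ i ∈ Finset.range (min j (m - j) + 1),
        (((-1 : RatFunc ℚ) ^ j * q ^ (-(j : ℤ) - (i : ℤ) ^ 2) *
            gbinom ((q ^ 2)⁻¹) (m - i) j * gbinom ((q ^ 2)⁻¹) j i) •
          (Kp ^ i * Km ^ j * X (m - i - j))) := by
  have hq₀ : q ≠ 0 := hq ▸ RatFunc.X_ne_zero
  have hqu : q * q⁻¹ = 1 := mul_inv_cancel₀ hq₀
  have hv (t : ℕ) : (q ^ 2) ^ (t + 1) - 1 ≠ 0 := by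
    rw [hq, ← pow_mul, ← RatFunc.algebraMap_X, ← map_pow,
      ← map_one (algebraMap (Polynomial ℚ) (RatFunc ℚ)), ← map_sub]
    exact RatFunc.algebraMap_ne_zero (Polynomial.X_pow_sub_C_ne_zero (by omega) 1)
  have hv' (t : ℕ) : (q⁻¹ ^ 2) ^ (t + 1) - 1 ≠ 0 := by
    intro h
    refine hv t ?_
    rw [sub_eq_zero, inv_pow, inv_pow, inv_eq_one] at h
    rw [h, sub_self]
  have hFKp : F * Kp = q ^ 2 • (Kp * F) := by
    rw [hKpF, smul_smul, ← mul_pow, hqu, one_pow, one_smul]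
  have hFKm : F * Km = q⁻¹ ^ 2 • (Km * F) := by
    rw [hKmF, smul_smul, ← mul_pow, mul_comm, hqu, one_pow, one_smul]
  have hFKp_pow (t : ℕ) : F ^ t * Kp = q ^ (2 * t) • (Kp * F ^ t) := by
    induction t with
    | zero => simp
    | succ t ih =>
      rw [pow_succ', mul_assoc, ih, mul_smul_comm, ← mul_assoc, hFKp, smul_mul_assoc, smul_smul,
        mul_assoc]
      ring_nf
  have hFKm_pow (t : ℕ) : F ^ t * Km = q⁻¹ ^ (2 * t) • (Km * F ^ t) := by
    induction t with
    | zero => simp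
    | succ t ih =>
      rw [pow_succ', mul_assoc, ih, mul_smul_comm, ← mul_assoc, hFKm, smul_mul_assoc, smul_smul,
        mul_assoc]
      ring_nf
  have hFEKp : Commute (F * E) Kp := by
    rw [commute_iff_eq, ← mul_assoc Kp, hKpF, smul_mul_assoc, mul_assoc F Kp, hKpE, mul_smul_comm,
      smul_smul, ← mul_pow, mul_comm q⁻¹, hqu, one_pow, one_smul, mul_assoc]
  have hFEKm : Commute (F * E) Km := by
    rw [commute_iff_eq, ← mul_assoc Km, hKmF, smul_mul_assoc, mul_assoc F Km, hKmE, mul_smul_comm,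
      smul_smul, ← mul_pow, hqu, one_pow, one_smul, mul_assoc]
  have hCKp : Commute C Kp := hC ▸
    (hFEKp.sub_left ((Commute.refl Kp).smul_left q)).sub_left ((Commute.symm hK).smul_left q⁻¹)
  have hCKm : Commute C Km := hC ▸
    (hFEKm.sub_left (Commute.smul_left hK q)).sub_left ((Commute.refl Km).smul_left q⁻¹)
  have hCF : Commute C F := by
    have hE : E * F = F * E + (q⁻¹ - q) • (Kp - Km) := by rw [← hEF]; abel
    rw [commute_iff_eq, hC, sub_mul, sub_mul, mul_assoc F, hE, smul_mul_assoc, smul_mul_assoc,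
      hKpF, hKmF]
    simp only [mul_add, mul_sub, mul_smul_comm]
    have h1 : q * q⁻¹ ^ 2 = q⁻¹ := by rw [pow_two, ← mul_assoc, hqu, one_mul]
    have h2 : q⁻¹ * q ^ 2 = q := by rw [mul_comm, pow_two, mul_assoc, hqu, mul_one]
    rw [smul_smul, smul_smul, h1, h2]
    simp only [sub_smul, smul_sub]
    abel
  have hY (t : ℕ) : C * (F ^ t * E ^ t) = F ^ (t + 1) * E ^ (t + 1)
      - q ^ (2 * t + 1) • (Kp * (F ^ t * E ^ t))
      - q⁻¹ ^ (2 * t + 1) • (Km * (F ^ t * E ^ t)) := by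
    rw [← mul_assoc, (hCF.pow_right t).eq, hC]
    simp only [mul_sub, sub_mul, mul_smul_comm, smul_mul_assoc, hFKp_pow, hFKm_pow, smul_smul]
    rw [pow_succ F, pow_succ' E, pow_succ' q, pow_succ' q⁻¹]
    simp only [mul_assoc]
  have hXH : X = bigHermite q Kp (fun t => F ^ t * E ^ t) := by
    funext t
    rw [hX, bigHermite]
    refine Finset.sum_congr rfl fun s hs => ?_
    rw [gbinom_eq_qbin _ (Nat.lt_succ_iff.1 (Finset.mem_range.1 hs)), mul_assoc (Kp ^ s)]
  have hrec := mul_bigHermite hqu hv hK hCKp hY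
  rw [← hXH] at hrec
  have hX₀ : X 0 = 1 := by simp [hXH, bigHermite]
  rw [cheb_eq_sum_chebCoeff hv' hK hCKp hCKm hX₀ hrec le_rfl]
  refine Finset.sum_congr rfl fun j hj => ?_
  have hj' := Finset.mem_range.1 hj
  symm
  refine Finset.sum_subset_zero_on_sdiff (Finset.range_subset_range.2 (by omega)) ?_ ?_
  · intro i hi
    rw [Finset.mem_sdiff, Finset.mem_range, Finset.mem_range] at hi
    rw [chebCoeff_eq_zero (by omega), zero_smul]
  · intro i hi
    rw [Finset.mem_range] at hi
    rw [gbinom_eq_qbin _ (by omega), gbinom_eq_qbin _ (by omega), chebCoeff, inv_pow q 2]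
    congr 4
    rw [inv_pow, ← zpow_natCast, ← zpow_neg]
    congr 1
    push_cast
    ring
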